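/- The partial order P(μ,λ) is λ-distributive: for every family of fewer than λ dense open subsets of P(μ,λ), the intersection of the family is dense. -/

import Mathlib

/-- `c` is unbounded in `β`. -/
def UnboundedIn (c : Set Ordinal) (β : Ordinal) : Prop :=
  ∀ γ < β, ∃ x ∈ c, γ ≤ x ∧ x < β

/-- `c` is closed in `β`: it contains each of its limit points below `β`. -/
def ClosedIn (c : Set Ordinal) (β : Ordinal) : Prop :=
  ∀ γ < β, 0 < γ → (∀ δ < γ, ∃ x ∈ c, δ < x ∧ x < γ) → γ ∈ c

/-- `A` is non-stationary in `β`: some subset of `β` which is closed and unbounded in `β`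
is disjoint from `A`. -/
def NonStationaryIn (A : Set Ordinal) (β : Ordinal) : Prop :=
  ∃ c : Set Ordinal, (∀ x ∈ c, x < β) ∧ UnboundedIn c β ∧ ClosedIn c β ∧ Disjoint c A

/-- A condition in the forcing `P(μ,λ)`: a function `p : S ∩ α → 2` for some `α < λ`,
where `S = {α < λ : cf α < μ}`, such that `p⁻¹(1)` is non-stationary in every `β ≤ α` of
cofinality `≥ μ`.  The function is encoded as `f : Ordinal → Option Bool` whose domain
(the set where `f` is `some _`) is exactly `S ∩ α`. -/
structure PCond (μ lam : Cardinal) where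
  f : Ordinal → Option Bool
  dom_spec : ∃ α < lam.ord, ∀ γ : Ordinal, (f γ).isSome ↔ (γ < α ∧ γ.cof < μ)
  nonstat : ∀ β : Ordinal, μ ≤ β.cof →
    (∀ γ < β, γ.cof < μ → (f γ).isSome) →
    NonStationaryIn {γ : Ordinal | f γ = some true} β

namespace PCond

variable {μ lam : Cardinal}

/-- The order on `P(μ,λ)` is end-extension: `p ≤ q` iff `p ⊇ q` as functions. -/
instance : PartialOrder (PCond μ lam) where
  le p q := ∀ γ : Ordinal, ∀ b : Bool, q.f γ = some b → p.f γ = some b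
  le_refl p := fun _ _ h => h
  le_trans p q r hpq hqr := fun γ b h => hpq γ b (hqr γ b h)
  le_antisymm p q hpq hqp := by
    have hf : p.f = q.f := by
      funext γ
      cases hp : p.f γ with
      | some b => exact (hqp γ b hp).symm
      | none =>
        cases hq : q.f γ with
        | some b => exact absurd (hpq γ b hq) (by simp [hp])
        | none => rfl
    cases p; cases q; simp_all

theorem le_def (p q : PCond μ lam) :
    p ≤ q ↔ ∀ γ : Ordinal, ∀ b : Bool, q.f γ = some b → p.f γ = some b := Iff.rfl

end PCond

/-- A subset of a partial order is dense open if every element has an extension in it and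
it is downwards closed. -/
def IsDenseOpen {P : Type*} [Preorder P] (D : Set P) : Prop :=
  (∀ p : P, ∃ q ∈ D, q ≤ p) ∧ (∀ p q : P, q ≤ p → p ∈ D → q ∈ D)

theorem NonStationaryIn.mono {A B : Set Ordinal} {β : Ordinal} (hA : NonStationaryIn A β)
    (h : ∀ γ < β, γ ∈ B → γ ∈ A) : NonStationaryIn B β := by
  obtain ⟨c, hc, hu, hcl, hd⟩ := hA
  refine ⟨c, hc, hu, hcl, Set.disjoint_left.2 fun x hx hxB => ?_⟩
  exact Set.disjoint_left.1 hd hx (h x (hc x hx) hxB)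

namespace PCond

variable {μ lam : Cardinal}

/-- `p` has domain `S ∩ α`, where `S` is the set of ordinals of cofinality below `μ`. -/
def HasHeight (p : PCond μ lam) (α : Ordinal) : Prop :=
  α < lam.ord ∧ ∀ γ : Ordinal, (p.f γ).isSome ↔ (γ < α ∧ γ.cof < μ)

/-- A condition together with a height for it. -/
abbrev Bounded (μ lam : Cardinal) :=
  {x : PCond μ lam × Ordinal // HasHeight x.1 x.2}

/-- A set of ordinals containing all `γ < β` with `cof γ < μ` is unbounded in `β`,
as it contains all successors. -/
theorem le_of_forall_cof_lt (hμ : Cardinal.aleph0 < μ) {α β : Ordinal}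
    (hβ : μ ≤ β.cof) (h : ∀ γ < β, γ.cof < μ → γ < α) : β ≤ α := by
  have hlim : Order.IsSuccLimit β := Ordinal.one_lt_cof_iff.1 <|
    Cardinal.one_lt_aleph0.trans_le (hμ.le.trans hβ)
  by_contra! hlt
  have h1 : Order.succ α < β := hlim.succ_lt hlt
  have h2 := h _ h1 (by
    rw [Order.succ_eq_add_one, Ordinal.cof_add_one]
    exact Cardinal.one_lt_aleph0.trans hμ)
  exact absurd (Order.le_succ α) h2.not_ge

/-- A condition extends by one more level, with value `0` there. -/
theorem exists_succ (hlam : Cardinal.aleph0 ≤ lam) (hμ : Cardinal.aleph0 < μ)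
    (t : Bounded μ lam) :
    ∃ t' : Bounded μ lam, t'.1.1 ≤ t.1.1 ∧ t'.1.2 = Order.succ t.1.2 ∧
      (t.1.2.cof < μ → t'.1.1.f t.1.2 = some false) := by
  classical
  obtain ⟨⟨p, α⟩, hα, hdom⟩ := t
  simp only at hα hdom
  have hnone : p.f α = none := by
    by_contra h
    exact absurd ((hdom α).1 (Option.isSome_iff_ne_none.2 h)).1 (lt_irrefl α)
  have hsucc : Order.succ α < lam.ord := (Cardinal.isSuccLimit_ord hlam).succ_lt hα
  let f : Ordinal → Option Bool := fun γ => if γ = α ∧ γ.cof < μ then some false else p.f γ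
  have hf : ∀ γ, (f γ).isSome ↔ (γ < Order.succ α ∧ γ.cof < μ) := by
    intro γ
    simp only [f]
    rw [Order.lt_succ_iff]
    split_ifs with h
    · simp [h.1.le, h.2]
    · rw [hdom]
      constructor
      · exact fun h => ⟨h.1.le, h.2⟩
      · exact fun h' => ⟨lt_of_le_of_ne h'.1 fun e => h ⟨e, h'.2⟩, h'.2⟩
  refine ⟨⟨⟨⟨f, ⟨_, hsucc, hf⟩, ?_⟩, Order.succ α⟩, hsucc, hf⟩, ?_, rfl, ?_⟩
  · intro β hβ hcov
    have hle : β ≤ Order.succ α :=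
      le_of_forall_cof_lt hμ hβ fun γ hγ hc => ((hf γ).1 (hcov γ hγ hc)).1
    have hlim : Order.IsSuccLimit β := Ordinal.one_lt_cof_iff.1 <|
    Cardinal.one_lt_aleph0.trans_le (hμ.le.trans hβ)
    have hle' : β ≤ α := by
      by_contra! hlt
      exact absurd (hlim.succ_lt hlt) hle.not_gt
    refine (p.nonstat β hβ fun γ hγ hc => (hdom γ).2 ⟨hγ.trans_le hle', hc⟩).mono ?_
    intro γ hγ hγf
    have : γ ≠ α := (hγ.trans_le hle').ne
    simpa [f, this] using hγf
  · intro γ b hb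
    have : γ ≠ α := by
      rintro rfl
      simp [hnone] at hb
    simpa [f, this] using hb
  · intro hc
    exact if_pos ⟨rfl, hc⟩

/-- A condition extends into a dense open set, with value not `1` at the old height. -/
theorem exists_step (hlam : Cardinal.aleph0 ≤ lam) (hμ : Cardinal.aleph0 < μ)
    {D : Set (PCond μ lam)} (hD : IsDenseOpen D) (t : Bounded μ lam) :
    ∃ t' : Bounded μ lam, t'.1.1 ≤ t.1.1 ∧ t.1.2 < t'.1.2 ∧ t'.1.1 ∈ D ∧
      t'.1.1.f t.1.2 ≠ some true := by
  obtain ⟨u, hut, hu, hu0⟩ := exists_succ hlam hμ t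
  obtain ⟨v, hvu, hv, hv0⟩ := exists_succ hlam hμ u
  obtain ⟨q, hqD, hqv⟩ := hD.1 v.1.1
  obtain ⟨α, hα, hdom⟩ := q.dom_spec
  refine ⟨⟨⟨q, α⟩, hα, hdom⟩, hqv.trans (hvu.trans hut), ?_, hqD, ?_⟩
  · have hc : u.1.2.cof < μ := by
      rw [hu, Order.succ_eq_add_one, Ordinal.cof_add_one]
      exact Cardinal.one_lt_aleph0.trans hμ
    have hlt := ((hdom _).1 (Option.isSome_iff_exists.2 ⟨_, hqv _ _ (hv0 hc)⟩)).1
    rw [hu] at hlt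
    exact (Order.lt_succ _).trans hlt
  · intro htrue
    have hc := ((hdom _).1 (Option.isSome_iff_exists.2 ⟨_, htrue⟩)).2
    have hfalse := (hqv.trans hvu) _ _ (hu0 hc)
    have := htrue.symm.trans hfalse
    simp at this

/-- `q` is a lower bound of `p` and of the family `G` of least possible height. -/
structure IsLimit {ι : Type} (p : Bounded μ lam) (G : ι → Bounded μ lam)
    (q : Bounded μ lam) : Prop where
  le_base : q.1.1 ≤ p.1.1
  le_family : ∀ i, q.1.1 ≤ (G i).1.1
  height : IsLUB (insert p.1.2 (Set.range fun i => (G i).1.2)) q.1.2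

theorem IsLimit.base_le {ι : Type} {p : Bounded μ lam} {G : ι → Bounded μ lam}
    {q : Bounded μ lam} (h : IsLimit p G q) : p.1.2 ≤ q.1.2 :=
  h.height.1 (Set.mem_insert _ _)

theorem IsLimit.family_le {ι : Type} {p : Bounded μ lam} {G : ι → Bounded μ lam}
    {q : Bounded μ lam} (h : IsLimit p G q) (i : ι) : (G i).1.2 ≤ q.1.2 :=
  h.height.1 (Set.mem_insert_of_mem _ ⟨i, rfl⟩)

/-- An extension agrees with the original condition below the height of the latter. -/
theorem eq_of_le {p q : Bounded μ lam} (h : q.1.1 ≤ p.1.1) {γ : Ordinal} (hγ : γ < p.1.2)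
    (hqp : (q.1.1.f γ).isSome → γ.cof < μ) :
    q.1.1.f γ = p.1.1.f γ := by
  by_cases hc : γ.cof < μ
  · obtain ⟨b, hb⟩ := Option.isSome_iff_exists.1 ((p.2.2 γ).2 ⟨hγ, hc⟩)
    rw [hb, h γ b hb]
  · have h1 : ¬ (q.1.1.f γ).isSome := fun hs => hc (hqp hs)
    have h2 : ¬ (p.1.1.f γ).isSome := fun hs => hc ((p.2.2 γ).1 hs).2
    rw [Option.not_isSome_iff_eq_none] at h1 h2
    rw [h1, h2]

/-- A descending family of conditions has a lower bound, provided that the conditions do not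
take the value `1` at the heights of the limits of its initial segments. -/
theorem exists_isLimit (hlam : lam.IsRegular) (hμ : Cardinal.aleph0 < μ)
    {ι : Type} [LinearOrder ι] [WellFoundedLT ι] (hι : Cardinal.mk ι < lam)
    (p : Bounded μ lam) (F G : ι → Bounded μ lam)
    (hF : ∀ i, IsLimit p (fun j : Set.Iio i => G j) (F i))
    (hGF : ∀ i, (G i).1.1 ≤ (F i).1.1) (hlt : ∀ i, (F i).1.2 < (G i).1.2)
    (h0 : ∀ i, (G i).1.1.f (F i).1.2 ≠ some true) :
    ∃ q, IsLimit p G q := by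
  classical
  have hFG : ∀ i j, i < j → (F j).1.1 ≤ (G i).1.1 := fun i j h => (hF j).le_family ⟨i, h⟩
  have hFGht : ∀ i j, i < j → (G i).1.2 ≤ (F j).1.2 := fun i j h => (hF j).family_le ⟨i, h⟩
  have hmono : ∀ i j, i < j → (F i).1.2 < (F j).1.2 := fun i j h =>
    (hlt i).trans_le (hFGht i j h)
  have hanti : ∀ i j, i ≤ j → (G j).1.1 ≤ (G i).1.1 := by
    intro i j h
    rcases h.eq_or_lt with rfl | h
    · exact le_rfl
    · exact (hGF j).trans (hFG i j h)
  have hGp : ∀ i, (G i).1.1 ≤ p.1.1 := fun i => (hGF i).trans (hF i).le_base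
  have hagree : ∀ i j γ, γ < (G i).1.2 → γ < (G j).1.2 →
      (G i).1.1.f γ = (G j).1.1.f γ := by
    intro i j γ hi hj
    rcases le_total i j with h | h
    · exact (eq_of_le (hanti _ _ h) hi fun hs => (((G j).2.2 γ).1 hs).2).symm
    · exact eq_of_le (hanti _ _ h) hj fun hs => (((G i).2.2 γ).1 hs).2
  let f : Ordinal → Option Bool := fun γ =>
    if h : ∃ i, γ < (G i).1.2 then (G h.choose).1.1.f γ else p.1.1.f γ
  have hfG : ∀ i γ, γ < (G i).1.2 → f γ = (G i).1.1.f γ := by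
    intro i γ h
    have hex : ∃ i, γ < (G i).1.2 := ⟨i, h⟩
    simp only [f, dif_pos hex]
    exact hagree _ _ _ hex.choose_spec h
  have hfp : ∀ γ, γ < p.1.2 → f γ = p.1.1.f γ := by
    intro γ h
    by_cases hex : ∃ i, γ < (G i).1.2
    · obtain ⟨i, hi⟩ := hex
      rw [hfG i γ hi]
      exact eq_of_le (hGp i) h fun hs => (((G i).2.2 γ).1 hs).2
    · simp only [f, dif_neg hex]
  let α : Ordinal := max p.1.2 (⨆ i, (G i).1.2)
  have hα : α < lam.ord := by
    refine max_lt p.2.1 (Ordinal.iSup_lt_of_lt_cof ?_ fun i => (G i).2.1)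
    rwa [hlam.cof_ord]
  have hlub : IsLUB (insert p.1.2 (Set.range fun i => (G i).1.2)) α := by
    refine ⟨?_, fun x hx => max_le (hx (Set.mem_insert _ _))
      (Ordinal.iSup_le fun i => hx (Set.mem_insert_of_mem _ ⟨i, rfl⟩))⟩
    rintro x (rfl | ⟨i, rfl⟩)
    · exact le_max_left _ _
    · exact (Ordinal.le_iSup (fun i => (G i).1.2) i).trans (le_max_right _ _)
  have hdom : ∀ γ, (f γ).isSome ↔ (γ < α ∧ γ.cof < μ) := by
    intro γ
    constructor
    · intro hs
      by_cases hex : ∃ i, γ < (G i).1.2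
      · obtain ⟨i, hi⟩ := hex
        rw [hfG i γ hi] at hs
        exact ⟨hi.trans_le (hlub.1 (Set.mem_insert_of_mem _ ⟨i, rfl⟩)),
          (((G i).2.2 γ).1 hs).2⟩
      · simp only [f, dif_neg hex] at hs
        have := (p.2.2 γ).1 hs
        exact ⟨this.1.trans_le (hlub.1 (Set.mem_insert _ _)), this.2⟩
    · rintro ⟨hγ, hc⟩
      obtain ⟨x, hx, hγx⟩ := (lt_isLUB_iff hlub).1 hγ
      rcases hx with rfl | ⟨i, rfl⟩
      · rw [hfp γ hγx]
        exact (p.2.2 γ).2 ⟨hγx, hc⟩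
      · rw [hfG i γ hγx]
        exact ((G i).2.2 γ).2 ⟨hγx, hc⟩
  have hnonstat : ∀ β : Ordinal, μ ≤ β.cof →
      (∀ γ < β, γ.cof < μ → (f γ).isSome) →
      NonStationaryIn {γ : Ordinal | f γ = some true} β := by
    intro β hβ hcov
    have hle : β ≤ α :=
      le_of_forall_cof_lt hμ hβ fun γ hγ hc => ((hdom γ).1 (hcov γ hγ hc)).1
    by_cases hp : β ≤ p.1.2
    · refine (p.1.1.nonstat β hβ fun γ hγ hc =>
        (p.2.2 γ).2 ⟨hγ.trans_le hp, hc⟩).mono fun γ hγ hf => ?_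
      exact (hfp γ (hγ.trans_le hp)).symm.trans hf
    by_cases hG : ∃ i, β ≤ (G i).1.2
    · obtain ⟨i, hi⟩ := hG
      refine ((G i).1.1.nonstat β hβ fun γ hγ hc =>
        ((G i).2.2 γ).2 ⟨hγ.trans_le hi, hc⟩).mono fun γ hγ hf => ?_
      exact (hfG i γ (hγ.trans_le hi)).symm.trans hf
    push Not at hp hG
    have hcofinal : ∀ γ < β, ∃ i, γ < (F i).1.2 := by
      have hG' : ∀ γ < β, p.1.2 ≤ γ → ∃ i, γ < (G i).1.2 := by
        intro γ hγ hpγ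
        obtain ⟨x, hx, hγx⟩ := (lt_isLUB_iff hlub).1 (hγ.trans_le hle)
        rcases hx with rfl | ⟨i, rfl⟩
        · exact absurd hγx hpγ.not_gt
        · exact ⟨i, hγx⟩
      intro γ hγ
      obtain ⟨i, hi⟩ := hG' _ (max_lt hγ hp) (le_max_right _ _)
      obtain ⟨j, hj⟩ := hG' _ (hG i) ((le_max_right _ _).trans hi.le)
      have hij : i < j := by
        by_contra! hji
        rcases hji.eq_or_lt with rfl | hji
        · exact lt_irrefl _ hj
        · exact absurd (hj.trans_le ((hFGht j i hji).trans (hlt i).le)) (lt_irrefl _)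
      exact ⟨j, ((le_max_left _ _).trans_lt hi).trans_le (hFGht i j hij)⟩
    refine ⟨Set.range fun i => (F i).1.2, ?_, ?_, ?_, ?_⟩
    · rintro _ ⟨i, rfl⟩
      exact (hlt i).trans (hG i)
    · intro γ hγ
      obtain ⟨i, hi⟩ := hcofinal γ hγ
      exact ⟨_, ⟨i, rfl⟩, hi.le, (hlt i).trans (hG i)⟩
    · intro γ hγ hγ0 hlim
      obtain ⟨j, hj, hmin⟩ := WellFounded.has_min (wellFounded_lt (α := ι))
        {j | γ ≤ (F j).1.2} ((hcofinal γ hγ).imp fun _ h => h.le)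
      refine ⟨j, le_antisymm ((hF j).height.2 ?_) hj⟩
      rintro x (rfl | ⟨⟨i, hi⟩, rfl⟩)
      · obtain ⟨_, ⟨k, rfl⟩, _, hk⟩ := hlim 0 hγ0
        exact (hF k).base_le.trans hk.le
      · have hiγ : (F i).1.2 < γ := lt_of_not_ge fun h => hmin i h hi
        obtain ⟨_, ⟨k, rfl⟩, hik, hk⟩ := hlim _ hiγ
        have : i < k := by
          by_contra! hki
          rcases hki.eq_or_lt with rfl | hki
          · exact lt_irrefl _ hik
          · exact lt_asymm hik (hmono k i hki)
        exact (hFGht i k this).trans hk.le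
    · rw [Set.disjoint_left]
      rintro _ ⟨i, rfl⟩ hf
      exact h0 i ((hfG i _ (hlt i)).symm.trans hf)
  refine ⟨⟨⟨⟨f, ⟨α, hα, hdom⟩, hnonstat⟩, α⟩, hα, hdom⟩, ?_, fun i => ?_, hlub⟩
  · intro γ b hb
    have hγ := ((p.2.2 γ).1 (Option.isSome_iff_exists.2 ⟨b, hb⟩)).1
    exact (hfp γ hγ).trans hb
  · intro γ b hb
    have hγ := (((G i).2.2 γ).1 (Option.isSome_iff_exists.2 ⟨b, hb⟩)).1
    exact (hfG i γ hγ).trans hb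

end PCond

/-- If `λ` is regular uncountable and `μ < λ` is regular uncountable, then the forcing
`P(μ,λ)` is `λ`-distributive: the intersection of fewer than `λ` dense open subsets is
dense. -/
theorem PCond_lambda_distributive (μ lam : Cardinal)
    (hlam : lam.IsRegular) (hlam' : Cardinal.aleph0 < lam)
    (hμ : μ.IsRegular) (hμ' : Cardinal.aleph0 < μ) (hμlam : μ < lam)
    (ι : Type) (D : ι → Set (PCond μ lam)) (hcard : Cardinal.mk ι < lam)
    (hD : ∀ i : ι, IsDenseOpen (D i)) :
    ∀ p : PCond μ lam, ∃ q : PCond μ lam, q ≤ p ∧ ∀ i : ι, q ∈ D i := by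
  classical
  intro p
  obtain ⟨α, hα, hdom⟩ := p.dom_spec
  let t : PCond.Bounded μ lam := ⟨⟨p, α⟩, hα, hdom⟩
  obtain ⟨_, _⟩ := exists_wellFoundedLT ι
  choose step hle hlt hmem h0 using
    fun i => PCond.exists_step hlam'.le hμ' (hD i)
  let L (i : ι) (g : Set.Iio i → PCond.Bounded μ lam) : PCond.Bounded μ lam :=
    if h : ∃ q, PCond.IsLimit t g q then h.choose else t
  let G : ι → PCond.Bounded μ lam :=
    (wellFounded_lt (α := ι)).fix fun i g => step i (L i fun j => g j j.2)
  let F (i : ι) : PCond.Bounded μ lam := L i fun j => G j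
  have hG : ∀ i, G i = step i (F i) := fun i => WellFounded.fix_eq _ _ i
  have hGF : ∀ i, (G i).1.1 ≤ (F i).1.1 := fun i => hG i ▸ hle i (F i)
  have hFlt : ∀ i, (F i).1.2 < (G i).1.2 := fun i => hG i ▸ hlt i (F i)
  have hG0 : ∀ i, (G i).1.1.f (F i).1.2 ≠ some true := fun i => hG i ▸ h0 i (F i)
  have hF : ∀ i, PCond.IsLimit t (fun j : Set.Iio i => G j) (F i) := by
    intro i
    induction i using WellFoundedLT.induction with
    | ind i ih =>
      have hex : ∃ q, PCond.IsLimit t (fun j : Set.Iio i => G j) q := by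
        refine PCond.exists_isLimit hlam hμ' ((Cardinal.mk_set_le _).trans_lt hcard) t
          (fun j => F j) (fun j => G j) (fun j => ?_) (fun j => hGF j) (fun j => hFlt j)
          (fun j => hG0 j)
        have hj := ih j j.2
        refine ⟨hj.le_base, fun k => hj.le_family ⟨k, k.2⟩, ?_⟩
        convert hj.height using 3
        ext x
        constructor
        · rintro ⟨k, rfl⟩
          exact ⟨⟨k, k.2⟩, rfl⟩
        · rintro ⟨k, rfl⟩
          exact ⟨⟨⟨k, lt_trans k.2 j.2⟩, k.2⟩, rfl⟩
      simp only [F, L, dif_pos hex]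
      exact hex.choose_spec
  obtain ⟨q, hq⟩ := PCond.exists_isLimit hlam hμ' hcard t F G hF hGF hFlt hG0
  exact ⟨q.1.1, hq.le_base, fun i =>
    (hD i).2 _ _ (hq.le_family i) (by rw [hG i]; exact hmem i (F i))⟩
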